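/- Let θ be a real number such that for some constant c' > 0, |θ − p/q| > c' / (q² (log q)²) for all integers p and positive integers q (with log q = max{1, log₂ q}). Then there is a constant C > 0 such that for all N ≥ 2 the discrepancy of the sequence of fractional parts ({nθ})_{n≥1} satisfies D_N({nθ}) ≤ C (log N)³. -/

import Mathlib

noncomputable section

/-- `plog q = max {1, log₂ q}`. -/
def plog (q : ℕ) : ℝ := max 1 (Real.logb 2 q)

/-- The counting function of the sequence `({nθ})_{n ≥ 1}`: the number of
`1 ≤ n ≤ N` with fractional part `{nθ} ∈ [0, x)`. -/
def fractCount (θ : ℝ) (N : ℕ) (x : ℝ) : ℕ :=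
  {n : ℕ | 1 ≤ n ∧ n ≤ N ∧ Int.fract ((n : ℝ) * θ) < x}.ncard

theorem one_le_plog (n : ℕ) : 1 ≤ plog n := le_max_left _ _

theorem plog_mono {m n : ℕ} (hm : 0 < m) (h : m ≤ n) : plog m ≤ plog n := by
  refine max_le_max le_rfl (Real.logb_le_logb_of_le (by norm_num) ?_ ?_) <;> exact_mod_cast ‹_›

theorem fractCount_eq_card (θ : ℝ) (N : ℕ) (x : ℝ) :
    fractCount θ N x = ((Finset.Ioc 0 N).filter fun n : ℕ => Int.fract ((n : ℝ) * θ) < x).card := by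
  rw [fractCount, ← Set.ncard_coe_finset]
  congr 1
  ext n
  simp [Nat.succ_le_iff, and_assoc]

theorem fractCount_add (θ : ℝ) (M q : ℕ) (x : ℝ) :
    fractCount θ (M + q) x = fractCount θ M x +
      ((Finset.Ioc M (M + q)).filter fun n : ℕ => Int.fract ((n : ℝ) * θ) < x).card := by
  rw [fractCount_eq_card, fractCount_eq_card,
    ← Finset.Ioc_union_Ioc_eq_Ioc (Nat.zero_le M) (Nat.le_add_right M q), Finset.filter_union,
    Finset.card_union_of_disjoint]
  exact Finset.disjoint_filter_filter (Finset.Ioc_disjoint_Ioc_of_le le_rfl)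

/-- Multiplication by a residue coprime to `q` followed by a translation permutes the residues
modulo `q`; in particular it is injective on `q` consecutive integers. -/
theorem injOn_mul_add_emod {p : ℤ} {q : ℕ} (hpq : IsCoprime p (q : ℤ)) (s : ℤ) (M : ℕ) :
    Set.InjOn (fun n : ℕ => (s + ((n : ℤ) - M) * p) % (q : ℤ)) (Finset.Ioc M (M + q)) := by
  intro m hm n hn h
  simp only [Finset.coe_Ioc, Set.mem_Ioc] at hm hn
  have hdvd : (q : ℤ) ∣ ((n : ℤ) - m) * p := by
    convert Int.ModEq.dvd (n := (q : ℤ)) h using 1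
    ring
  have h' := hpq.symm.dvd_of_dvd_mul_right hdvd
  have : (n : ℤ) - m = 0 := Int.eq_zero_of_abs_lt_dvd h' (by rw [abs_lt]; omega)
  omega

/-- The points `nθ`, for `n` in a block of `q` consecutive integers, stay close to the points
`k / q` when `θ` is close to `p / q`. -/
theorem exists_emod_approx {θ : ℝ} {p : ℤ} {q : ℕ} (hq : 0 < q)
    (hθ : |θ - (p : ℝ) / q| ≤ 1 / (q : ℝ) ^ 2) (M : ℕ) :
    ∃ s : ℤ, ∀ n ∈ Finset.Ioc M (M + q),
      let k := (s + ((n : ℤ) - M) * p) % (q : ℤ)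
      0 ≤ k ∧ k < q ∧ (1 ≤ k → k ≤ (q : ℤ) - 3 →
        (k : ℝ) - 1 ≤ q * Int.fract ((n : ℝ) * θ) ∧ q * Int.fract ((n : ℝ) * θ) < k + 2) := by
  have hq' : (0 : ℝ) < q := by exact_mod_cast hq
  refine ⟨⌊(q : ℝ) * (M * θ)⌋, fun n hn => ?_⟩
  set s := ⌊(q : ℝ) * (M * θ)⌋
  rw [Finset.mem_Ioc] at hn
  intro k
  refine ⟨Int.emod_nonneg _ (by omega), Int.emod_lt_of_pos _ (by omega), fun h1 h2 => ?_⟩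
  have hdiv := Int.emod_add_mul_ediv (s + ((n : ℤ) - M) * p) (q : ℤ)
  change k + _ = _ at hdiv
  set t := (s + ((n : ℤ) - M) * p) / (q : ℤ)
  have hdiv' : (k : ℝ) + q * t = s + ((n : ℝ) - M) * p := by exact_mod_cast hdiv
  have hs1 : (s : ℝ) ≤ q * (M * θ) := Int.floor_le _
  have hs2 : q * (M * θ) < (s : ℝ) + 1 := Int.lt_floor_add_one _
  have hj0 : (0 : ℝ) ≤ (n : ℝ) - M := by
    have : (M : ℝ) ≤ n := by exact_mod_cast hn.1.le
    linarith
  have hjq : (n : ℝ) - M ≤ q := by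
    have : (n : ℝ) ≤ M + q := by exact_mod_cast hn.2
    linarith
  have hδ : |((n : ℝ) - M) * (q * θ - p)| ≤ 1 := by
    have h3 : (q : ℝ) * θ - p = q * (θ - p / q) := by field_simp
    rw [h3, abs_mul, abs_mul, abs_of_nonneg hj0, abs_of_pos hq']
    calc ((n : ℝ) - M) * (q * |θ - p / q|) ≤ q * (q * (1 / (q : ℝ) ^ 2)) := by gcongr
      _ = 1 := by field_simp
  rw [abs_le] at hδ
  have hsum : (q : ℝ) * (n * θ) - q * t
      = k + (q * (M * θ) - s) + ((n : ℝ) - M) * (q * θ - p) := by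
    linear_combination -hdiv'
  have hk1 : (1 : ℝ) ≤ k := by exact_mod_cast h1
  have hk2 : (k : ℝ) ≤ q - 3 := by exact_mod_cast h2
  have hfloor : ⌊(n : ℝ) * θ⌋ = t := by
    rw [Int.floor_eq_iff]
    constructor
    · refine le_of_mul_le_mul_left ?_ hq'
      linarith
    · refine lt_of_mul_lt_mul_left ?_ hq'.le
      linarith
  rw [Int.fract, hfloor, mul_sub, hsum]
  constructor <;> linarith

/-- A block of `q` consecutive multiples of `θ` has bounded discrepancy when `p / q` is a good
rational approximation of `θ`. -/
theorem abs_card_block_sub_le {θ : ℝ} {p : ℤ} {q : ℕ} (hq : 0 < q)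
    (hpq : IsCoprime p (q : ℤ)) (hθ : |θ - (p : ℝ) / q| ≤ 1 / (q : ℝ) ^ 2) (M : ℕ)
    {x : ℝ} (hx : x ∈ Set.Icc (0 : ℝ) 1) :
    |(((Finset.Ioc M (M + q)).filter fun n : ℕ => Int.fract ((n : ℝ) * θ) < x).card : ℝ)
      - q * x| ≤ 5 := by
  have hq' : (0 : ℝ) < q := by exact_mod_cast hq
  obtain ⟨s, hs⟩ := exists_emod_approx hq hθ M
  have hinj := injOn_mul_add_emod hpq s M
  set f : ℕ → ℤ := fun n => (s + ((n : ℤ) - M) * p) % (q : ℤ)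
  have hqx0 : 0 ≤ (q : ℝ) * x := mul_nonneg hq'.le hx.1
  have hqx1 : (q : ℝ) * x ≤ q := mul_le_of_le_one_right hq'.le hx.2
  set u := ⌊(q : ℝ) * x⌋
  have hu1 : (u : ℝ) ≤ q * x := Int.floor_le _
  have hu2 : (q : ℝ) * x < u + 1 := Int.lt_floor_add_one _
  have hu0 : 0 ≤ u := Int.floor_nonneg.2 hqx0
  have huq : u ≤ q := by exact_mod_cast hu1.trans hqx1
  have hle : ((Finset.Ioc M (M + q)).filter fun n : ℕ => Int.fract ((n : ℝ) * θ) < x).card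
      ≤ (Finset.Icc 0 (u + 1) ∪ Finset.Ico ((q : ℤ) - 2) q).card := by
    refine Finset.card_le_card_of_injOn f ?_ (hinj.mono fun n hn => (Finset.mem_filter.1 hn).1)
    intro n hn
    obtain ⟨hn, hlt⟩ := Finset.mem_filter.1 hn
    obtain ⟨h0, h1, h2⟩ := hs n hn
    change 0 ≤ f n at h0
    change f n < q at h1
    change 1 ≤ f n → f n ≤ _ → _ at h2
    simp only [Finset.coe_union, Set.mem_union, Finset.mem_coe, Finset.mem_Icc, Finset.mem_Ico]
    by_contra hcon
    have h3 := (h2 (by omega) (by omega)).1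
    have h4 : (q : ℝ) * Int.fract ((n : ℝ) * θ) < q * x := by gcongr
    have h5 : (f n : ℝ) < ((u + 2 : ℤ) : ℝ) := by
      push_cast
      change (f n : ℝ) - 1 ≤ _ at h3
      linarith
    have h6 : f n < u + 2 := by exact_mod_cast h5
    omega
  have hge : ((Finset.Ioc M (M + q)).filter fun n : ℕ => ¬ Int.fract ((n : ℝ) * θ) < x).card
      ≤ (Finset.Ico (u - 1) q ∪ {0, (q : ℤ) - 2} : Finset ℤ).card := by
    refine Finset.card_le_card_of_injOn f ?_ (hinj.mono fun n hn => (Finset.mem_filter.1 hn).1)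
    intro n hn
    obtain ⟨hn, hlt⟩ := Finset.mem_filter.1 hn
    obtain ⟨h0, h1, h2⟩ := hs n hn
    change 0 ≤ f n at h0
    change f n < q at h1
    change 1 ≤ f n → f n ≤ _ → _ at h2
    simp only [Finset.coe_union, Set.mem_union, Finset.mem_coe, Finset.mem_Ico,
      Finset.mem_insert, Finset.mem_singleton]
    by_contra hcon
    have h3 := (h2 (by omega) (by omega)).2
    have h4 : (q : ℝ) * x ≤ q * Int.fract ((n : ℝ) * θ) := by
      gcongr
      exact not_lt.1 hlt
    have h5 : ((u : ℤ) : ℝ) < ((f n + 2 : ℤ) : ℝ) := by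
      push_cast
      change _ < (f n : ℝ) + 2 at h3
      linarith
    have h6 : u < f n + 2 := by exact_mod_cast h5
    omega
  have hle' := hle.trans (Finset.card_union_le _ _)
  have hge' := hge.trans (Finset.card_union_le _ _)
  have htot := Finset.card_filter_add_card_filter_not (s := Finset.Ioc M (M + q))
    (fun n : ℕ => Int.fract ((n : ℝ) * θ) < x)
  have hpair := Finset.card_le_two (a := (0 : ℤ)) (b := (q : ℤ) - 2)
  simp only [Int.card_Icc, Int.card_Ico, Nat.card_Ioc] at hle' hge' htot
  set c := ((Finset.Ioc M (M + q)).filter fun n : ℕ => Int.fract ((n : ℝ) * θ) < x).card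
  have hc1 : (c : ℤ) ≤ u + 4 := by omega
  have hc2 : u - 3 ≤ (c : ℤ) := by omega
  have hc1' : (c : ℝ) ≤ u + 4 := by exact_mod_cast hc1
  have hc2' : (u : ℝ) - 3 ≤ c := by exact_mod_cast hc2
  rw [abs_le]
  constructor <;> linarith

theorem abs_fractCount_add_mul_le {θ : ℝ} {p : ℤ} {q : ℕ} (hq : 0 < q)
    (hpq : IsCoprime p (q : ℤ)) (hθ : |θ - (p : ℝ) / q| ≤ 1 / (q : ℝ) ^ 2) (r b : ℕ)
    {x : ℝ} (hx : x ∈ Set.Icc (0 : ℝ) 1) :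
    |(fractCount θ (r + q * b) x : ℝ) - ((r + q * b : ℕ) : ℝ) * x|
      ≤ |(fractCount θ r x : ℝ) - r * x| + 5 * b := by
  induction b with
  | zero => simp
  | succ b ih =>
    have hblock := abs_card_block_sub_le hq hpq hθ (r + q * b) hx
    rw [Nat.mul_succ, ← add_assoc, fractCount_add]
    push_cast at ih ⊢
    rw [abs_le] at ih hblock ⊢
    constructor <;> linarith [ih.1, ih.2, hblock.1, hblock.2]

theorem abs_fractCount_sub_le {θ c' : ℝ} (hc' : 0 < c')
    (hθ : ∀ (p : ℤ) (q : ℕ), 0 < q →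
      |θ - (p : ℝ) / (q : ℝ)| > c' / ((q : ℝ) ^ 2 * (plog q) ^ 2))
    {x : ℝ} (hx : x ∈ Set.Icc (0 : ℝ) 1) (N : ℕ) :
    |(fractCount θ N x : ℝ) - N * x| ≤ 5 / c' * plog N ^ 2 * (Real.logb 2 N + 1) := by
  induction N using Nat.strong_induction_on with
  | _ N ih =>
  rcases Nat.eq_zero_or_pos N with rfl | hN
  · simp [fractCount_eq_card]
    positivity
  obtain ⟨a, ha, haN⟩ := Real.exists_rat_abs_sub_le_and_den_le θ hN
  have hq : 0 < a.den := a.den_pos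
  have hcop : IsCoprime a.num (a.den : ℤ) := by
    rw [Int.isCoprime_iff_nat_coprime]
    simpa using a.reduced
  rw [Rat.cast_def] at ha
  have hlow := (hθ a.num a.den hq).trans_le ha
  set q := a.den
  have hq' : (0 : ℝ) < q := by exact_mod_cast hq
  have hqN : (q : ℝ) ≤ N := by exact_mod_cast haN
  have hLq : 0 < plog q := zero_lt_one.trans_le (one_le_plog q)
  have happrox : |θ - (a.num : ℝ) / q| ≤ 1 / (q : ℝ) ^ 2 := by
    refine ha.trans ?_
    rw [sq]
    gcongr
    linarith
  have hquot : ((N / q : ℕ) : ℝ) ≤ plog N ^ 2 / c' := by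
    refine Nat.cast_div_le.trans ?_
    rw [div_lt_div_iff₀ (by positivity) (by positivity)] at hlow
    have h1 : c' * (N + 1) * q < q * plog q ^ 2 * q := by linarith
    have h2 := lt_of_mul_lt_mul_right h1 hq'.le
    have h3 : (q : ℝ) * plog q ^ 2 ≤ q * plog N ^ 2 := by
      gcongr
      exact plog_mono hq haN
    rw [div_le_div_iff₀ hq' hc']
    linarith
  have hsplit := abs_fractCount_add_mul_le hq hcop happrox (N % q) (N / q) hx
  rw [Nat.mod_add_div] at hsplit
  have hrq : N % q < q := Nat.mod_lt _ hq
  have hrec : |(fractCount θ (N % q) x : ℝ) - (N % q : ℕ) * x|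
      ≤ 5 / c' * plog N ^ 2 * Real.logb 2 N := by
    rcases Nat.eq_zero_or_pos (N % q) with h0 | hr
    · rw [h0]
      have : 0 ≤ Real.logb 2 N := Real.logb_nonneg (by norm_num) (by exact_mod_cast hN)
      simp [fractCount_eq_card]
      positivity
    · have hr' : (0 : ℝ) < (N % q : ℕ) := by exact_mod_cast hr
      have hhalf : 2 * (N % q) ≤ N := by
        have h1 := Nat.mod_add_div N q
        have h2 : q * 1 ≤ q * (N / q) := Nat.mul_le_mul_left _ (Nat.div_pos haN hq)
        omega
      have hlog : Real.logb 2 (N % q : ℕ) + 1 ≤ Real.logb 2 N := by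
        have h2 : Real.logb 2 (2 * ((N % q : ℕ) : ℝ)) ≤ Real.logb 2 N :=
          Real.logb_le_logb_of_le (by norm_num) (by positivity) (by exact_mod_cast hhalf)
        rw [Real.logb_mul (by norm_num) hr'.ne', Real.logb_self_eq_one (by norm_num)] at h2
        linarith
      have hlog0 : 0 ≤ Real.logb 2 (N % q : ℕ) :=
        Real.logb_nonneg (by norm_num) (by exact_mod_cast hr)
      have hL := one_le_plog (N % q)
      refine (ih _ (hrq.trans_le haN)).trans ?_
      gcongr
      exact plog_mono hr (by omega)
  calc |(fractCount θ N x : ℝ) - N * x|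
      ≤ 5 / c' * plog N ^ 2 * Real.logb 2 N + 5 * (plog N ^ 2 / c') :=
        hsplit.trans (by gcongr)
    _ = 5 / c' * plog N ^ 2 * (Real.logb 2 N + 1) := by ring

/-- If `|θ - p/q| > c'/(q² (log q)²)` for all integers `p` and positive integers `q`,
then the discrepancy of the sequence `({nθ})` satisfies `D_N({nθ}) ≤ C (log N)³`. -/
theorem one_dim_discrepancy_lacunary_type
    (θ : ℝ) (c' : ℝ) (hc' : 0 < c')
    (hθ : ∀ (p : ℤ) (q : ℕ), 0 < q →
      |θ - (p : ℝ) / (q : ℝ)| > c' / ((q : ℝ) ^ 2 * (plog q) ^ 2)) :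
    ∃ C : ℝ, 0 < C ∧ ∀ N : ℕ, 2 ≤ N → ∀ x ∈ Set.Icc (0:ℝ) 1,
      |(fractCount θ N x : ℝ) - (N : ℝ) * x| ≤ C * (plog N) ^ 3 := by
  refine ⟨10 / c', by positivity, fun N _ x hx => (abs_fractCount_sub_le hc' hθ hx N).trans ?_⟩
  have h1 : Real.logb 2 N ≤ plog N := le_max_right _ _
  have h2 := one_le_plog N
  calc 5 / c' * plog N ^ 2 * (Real.logb 2 N + 1)
      ≤ 5 / c' * plog N ^ 2 * (plog N + plog N) := by gcongr
    _ = 10 / c' * plog N ^ 3 := by ring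

end
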